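/- For every k ≥ 2 and all positive integers i_1,…,i_k with i_1+⋯+i_k = n, the iterated commutator [D∘L^{i_1−1},[D∘L^{i_2−1},[⋯,[D∘L^{i_{k−1}−1}, D∘L^{i_k−1}]⋯]]] of operators on ℂ[[z]] equals γ_{i_1,…,i_k} · D∘L^{n−1}, where γ_{i_1,…,i_k} = ∏_{j=1}^{k−1} ( i_j − (i_{j+1}+⋯+i_k) ). -/

import Mathlib

noncomputable section

/-- The formal differentiation operator `D` on `ℂ[[z]]`: `(Df)(z) = ∑ (k+1) c_{k+1} z^k`. -/
def Dop : Module.End ℂ (PowerSeries ℂ) where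
  toFun f := PowerSeries.mk fun k => ((k : ℂ) + 1) * PowerSeries.coeff (k + 1) f
  map_add' f g := by
    ext k
    simp [mul_add]
  map_smul' c f := by
    ext k
    simp
    ring

/-- The left translation operator `L` on `ℂ[[z]]`: `(Lf)(z) = ∑ c_{k+1} z^k`. -/
def Lop : Module.End ℂ (PowerSeries ℂ) where
  toFun f := PowerSeries.mk fun k => PowerSeries.coeff (k + 1) f
  map_add' f g := by ext k; simp
  map_smul' c f := by ext k; simp

/-- Iterated right-nested Lie bracket `[x₁,[x₂,[⋯,[x_{k-1},x_k]⋯]]]` of a list of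
endomorphisms (by convention `0` for the empty list). -/
def iterBracket : List (Module.End ℂ (PowerSeries ℂ)) → Module.End ℂ (PowerSeries ℂ)
  | [] => 0
  | [x] => x
  | x :: y :: l => ⁅x, iterBracket (y :: l)⁆

/-- `γ_{i₁,…,iₖ} = ∏_{j=1}^{k-1} (i_j − (i_{j+1}+⋯+i_k))` for the multi-index
`l = [i₁,…,iₖ]`. -/
def gammaCoeff (l : List ℕ) : ℂ :=
  ∏ j ∈ Finset.range (l.length - 1), ((l.getD j 0 : ℂ) - ((l.drop (j + 1)).sum : ℂ))

theorem coeff_Lop_pow (m k : ℕ) (f : PowerSeries ℂ) :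
    PowerSeries.coeff k ((Lop ^ m) f) = PowerSeries.coeff (k + m) f := by
  induction m generalizing k with
  | zero => simp
  | succ m ih =>
    rw [pow_succ', Module.End.mul_apply]
    simp only [Lop, LinearMap.coe_mk, AddHom.coe_mk, PowerSeries.coeff_mk] at ih ⊢
    rw [ih, add_right_comm, add_assoc]

theorem coeff_Dop_mul_Lop_pow (m k : ℕ) (f : PowerSeries ℂ) :
    PowerSeries.coeff k ((Dop * Lop ^ m) f) =
      ((k : ℂ) + 1) * PowerSeries.coeff (k + 1 + m) f := by
  rw [Module.End.mul_apply, ← coeff_Lop_pow]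
  simp [Dop]

theorem lie_Dop_mul_Lop_pow (p q : ℕ) :
    ⁅Dop * Lop ^ p, Dop * Lop ^ q⁆ = ((p : ℂ) - q) • (Dop * Lop ^ (p + q + 1)) := by
  refine LinearMap.ext fun f => PowerSeries.ext fun k => ?_
  rw [Ring.lie_def, LinearMap.sub_apply, map_sub, Module.End.mul_apply (Dop * Lop ^ p),
    Module.End.mul_apply (Dop * Lop ^ q), LinearMap.smul_apply, PowerSeries.coeff_smul]
  simp only [coeff_Dop_mul_Lop_pow]
  rw [show k + 1 + p + 1 + q = k + 1 + (p + q + 1) by ring,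
    show k + 1 + q + 1 + p = k + 1 + (p + q + 1) by ring]
  push_cast
  ring

theorem lie_smul_end (c : ℂ) (A B : Module.End ℂ (PowerSeries ℂ)) :
    ⁅A, c • B⁆ = c • ⁅A, B⁆ := by
  refine LinearMap.ext fun f => ?_
  rw [Ring.lie_def, Ring.lie_def, mul_smul_comm, smul_mul_assoc, LinearMap.smul_apply,
    LinearMap.sub_apply, LinearMap.sub_apply, LinearMap.smul_apply, LinearMap.smul_apply,
    smul_sub]

theorem gammaCoeff_cons_cons (x y : ℕ) (l : List ℕ) :
    gammaCoeff (x :: y :: l) = ((x : ℂ) - ((y :: l).sum : ℕ)) * gammaCoeff (y :: l) := by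
  simp [gammaCoeff, Finset.prod_range_succ', mul_comm]

/-- The bracket formula for every non-empty list; a singleton has empty product `γ = 1`. -/
theorem iterBracket_DL_cons (x : ℕ) (l : List ℕ) (hl : ∀ i ∈ x :: l, 1 ≤ i) :
    iterBracket ((x :: l).map fun i => Dop * Lop ^ (i - 1)) =
      gammaCoeff (x :: l) • (Dop * Lop ^ ((x :: l).sum - 1)) := by
  induction l generalizing x with
  | nil => simp [iterBracket, gammaCoeff]
  | cons y l ih =>
    have hx : 1 ≤ x := hl x (by simp)
    have hy : 1 ≤ y := hl y (by simp)
    have hs : 1 ≤ (y :: l).sum := by rw [List.sum_cons]; omega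
    have h := ih y fun i hi => hl i (List.mem_cons_of_mem _ hi)
    simp only [List.map_cons] at h ⊢
    rw [iterBracket, h, lie_smul_end, lie_Dop_mul_Lop_pow, smul_smul, gammaCoeff_cons_cons,
      List.sum_cons (a := x), Nat.cast_sub hx, Nat.cast_sub hs,
      show x - 1 + ((y :: l).sum - 1) + 1 = x + (y :: l).sum - 1 by omega]
    congr 1
    ring

/-- for `k ≥ 2` and positive `i₁,…,iₖ` with `i₁+⋯+iₖ = n`,
`[D∘L^{i₁−1},[D∘L^{i₂−1},[⋯,[D∘L^{i_{k−1}−1}, D∘L^{iₖ−1}]⋯]]] = γ_{i₁,…,iₖ} · D∘L^{n−1}`. -/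
theorem iterBracket_DL (l : List ℕ) (hk : 2 ≤ l.length) (hl : ∀ i ∈ l, 1 ≤ i) :
    iterBracket (l.map fun i => Dop * Lop ^ (i - 1)) =
      gammaCoeff l • (Dop * Lop ^ (l.sum - 1)) := by
  cases l with
  | nil => simp at hk
  | cons x l => exact iterBracket_DL_cons x l hl
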